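/- Let R be a π-adically complete, π-torsion-free commutative ring (π ∈ R a non-zero-divisor), and let f_1, …, f_n ∈ R be elements generating, together with π, the unit ideal: (f_1, …, f_n) + (π) = R. Let x ∈ R[1/π]. If for every i the image of x in R⟨1/f_i⟩[1/π] is integral over the π-adic completion R⟨1/f_i⟩ of R[1/f_i], then x is integral over R. -/

import Mathlib

/-- `R⟨1/g⟩`: the `π`-adic completion of the localization `R[1/g]`. -/
noncomputable abbrev piComplAway (R : Type*) [CommRing R] (π g : R) : Type _ :=
  AdicCompletion (Ideal.span {algebraMap R (Localization.Away g) π}) (Localization.Away g)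

open Polynomial in
theorem isIntegral_of_pow_mem_map_degreeLT {R A : Type*} [CommRing R] [CommRing A] [Algebra R A]
    {x : A} {d : ℕ} (h : x ^ d ∈ (degreeLT R d).map (aeval x).toLinearMap) : IsIntegral R x := by
  obtain ⟨p, hp, hpx⟩ := h
  refine ⟨X ^ d - p, monic_X_pow_sub (mem_degreeLT.1 hp), ?_⟩
  have : aeval x p = x ^ d := hpx
  rw [← aeval_def]
  simp [this]

open Polynomial in
theorem smul_pow_mem_map_degreeLT {R A : Type*} [CommRing R] [CommRing A] [Algebra R A]
    {x : A} {m : ℕ} {u r : R} {c : ℕ → R}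
    (h : u • x ^ m + ∑ j ∈ Finset.range m, c j • x ^ j = algebraMap R A r)
    (hm : 0 < m) {d : ℕ} (hd : m < d) :
    u • x ^ d ∈ (degreeLT R d).map (aeval x).toLinearMap := by
  have hpow (j : ℕ) (hj : j < d) : x ^ j ∈ (degreeLT R d).map (aeval x).toLinearMap :=
    ⟨X ^ j, mem_degreeLT.2 ((degree_X_pow_le j).trans_lt (by exact_mod_cast hj)), by simp⟩
  obtain ⟨e, rfl⟩ := Nat.exists_eq_add_of_lt hd
  have key : u • x ^ (m + e + 1) =
      r • x ^ (e + 1) - ∑ j ∈ Finset.range m, c j • x ^ (j + (e + 1)) := by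
    have := congrArg (· * x ^ (e + 1)) h
    simp only [add_mul, Finset.sum_mul, smul_mul_assoc, ← pow_add, ← Algebra.smul_def] at this
    rw [← this, add_assoc m]
    ring
  rw [key]
  refine sub_mem (Submodule.smul_mem _ _ (hpow _ (by omega))) (sum_mem fun j hj ↦ ?_)
  have := Finset.mem_range.1 hj
  exact Submodule.smul_mem _ _ (hpow _ (by omega))

/-- An integral equation of a fraction `a / π ^ k`, with denominators cleared. -/
theorem exists_cleared_equation_of_isIntegral_awayMap {R T : Type*} [CommRing R] [CommRing T]
    (φ : R →+* T) {π : R} {x : Localization.Away π} {k : ℕ} {a : R}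
    (ha : x * algebraMap R _ π ^ k = algebraMap R _ a)
    (hx : IsIntegral T (Localization.awayMap φ π x)) :
    ∃ (m L : ℕ) (c : ℕ → T), 0 < m ∧ φ π ^ L *
      (φ a ^ m + ∑ j ∈ Finset.range m, c j * φ π ^ (k * (m - j)) * φ a ^ j) = 0 := by
  cases subsingleton_or_nontrivial T
  · exact ⟨1, 0, 0, one_pos, Subsingleton.elim _ _⟩
  obtain ⟨p, hp, hpd, hpx⟩ : ∃ p : Polynomial T, p.Monic ∧ 0 < p.natDegree ∧
      p.eval₂ (algebraMap T _) (Localization.awayMap φ π x) = 0 := by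
    obtain ⟨p, hp, hpx⟩ := hx
    exact ⟨p * Polynomial.X, hp.mul Polynomial.monic_X,
      by simp [Polynomial.natDegree_mul_X hp.ne_zero], by simp [hpx]⟩
  set y := Localization.awayMap φ π x with hy
  have hya : y * algebraMap T (Localization.Away (φ π)) (φ π) ^ k = algebraMap T _ (φ a) := by
    have := congrArg (Localization.awayMap φ π) ha
    simpa [hy, Localization.awayMap, IsLocalization.Away.map, IsLocalization.map_eq] using this
  have h0 : algebraMap T (Localization.Away (φ π)) (φ a ^ p.natDegree +
      ∑ j ∈ Finset.range p.natDegree,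
        p.coeff j * φ π ^ (k * (p.natDegree - j)) * φ a ^ j) = algebraMap T _ 0 := by
    rw [hp.as_sum] at hpx
    simp only [Polynomial.eval₂_add, Polynomial.eval₂_finsetSum, Polynomial.eval₂_mul,
      Polynomial.eval₂_C, Polynomial.eval₂_pow, Polynomial.eval₂_X] at hpx
    have := congrArg (· * algebraMap T (Localization.Away (φ π)) (φ π) ^ (k * p.natDegree)) hpx
    simp only [add_mul, zero_mul, Finset.sum_mul] at this
    rw [map_zero, ← this]
    simp only [map_add, map_sum, map_mul, map_pow, ← hya]
    congr 1
    · rw [mul_pow, pow_mul]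
    · refine Finset.sum_congr rfl fun j hj ↦ ?_
      have hj' : k * p.natDegree = k * (p.natDegree - j) + k * j := by
        rw [← mul_add, Nat.sub_add_cancel (Finset.mem_range.1 hj).le]
      rw [hj', mul_pow, ← pow_mul, pow_add]
      ring
  obtain ⟨⟨_, L, rfl⟩, hL⟩ := IsLocalization.exists_of_eq (M := Submonoid.powers (φ π)) h0
  exact ⟨p.natDegree, L, p.coeff, hpd, by simpa using hL⟩

theorem exists_equation_modulo_pow_of_adicCompletion {S : Type*} [CommRing S] {p a : S}
    {k m L : ℕ} {c : ℕ → AdicCompletion (Ideal.span {p}) S}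
    (h : algebraMap S (AdicCompletion (Ideal.span {p}) S) p ^ L *
      (algebraMap S (AdicCompletion (Ideal.span {p}) S) a ^ m + ∑ j ∈ Finset.range m,
        c j * algebraMap S (AdicCompletion (Ideal.span {p}) S) p ^ (k * (m - j)) *
          algebraMap S (AdicCompletion (Ideal.span {p}) S) a ^ j) = 0) (N : ℕ) :
    ∃ (c' : ℕ → S) (s : S),
      p ^ L * (a ^ m + ∑ j ∈ Finset.range m, c' j * p ^ (k * (m - j)) * a ^ j) = p ^ N * s := by
  choose c' hc' using fun j ↦
    Ideal.Quotient.mk_surjective (AdicCompletion.evalₐ (Ideal.span {p}) N (c j))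
  refine ⟨c', ?_⟩
  have := congrArg (AdicCompletion.evalₐ (Ideal.span {p}) N) h
  simp only [map_mul, map_add, map_sum, map_pow, map_zero, AlgHom.commutes, ← hc',
    Ideal.Quotient.algebraMap_eq] at this
  simp only [← map_mul, ← map_add, ← map_sum, ← map_pow] at this
  rw [Ideal.Quotient.eq_zero_iff_mem, Ideal.span_singleton_pow, Ideal.mem_span_singleton] at this
  exact this

theorem exists_pow_mul_equation_of_localizationAway {R : Type*} [CommRing R] {π g a : R}
    {k m L N : ℕ} {c : ℕ → Localization.Away g} {s : Localization.Away g}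
    (h : algebraMap R (Localization.Away g) π ^ L * (algebraMap R (Localization.Away g) a ^ m +
      ∑ j ∈ Finset.range m, c j * algebraMap R (Localization.Away g) π ^ (k * (m - j)) *
        algebraMap R (Localization.Away g) a ^ j) =
      algebraMap R (Localization.Away g) π ^ N * s) :
    ∃ (M : ℕ) (r : ℕ → R) (t : R),
      π ^ L * (g ^ M * a ^ m + ∑ j ∈ Finset.range m, r j * π ^ (k * (m - j)) * a ^ j) =
        π ^ N * t := by
  obtain ⟨⟨_, M, rfl⟩, hM⟩ := IsLocalization.exist_integer_multiples_of_finite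
    (Submonoid.powers g) (fun o : Option (Fin m) ↦ o.elim s fun j ↦ c j)
  choose r hr using hM
  simp only [Algebra.smul_def] at hr
  let r' (j : ℕ) : R := if hj : j < m then r (some ⟨j, hj⟩) else 0
  have hr' (j : ℕ) (hj : j < m) : algebraMap R (Localization.Away g) (r' j) =
      algebraMap R _ (g ^ M) * c j := by
    simp only [r', dif_pos hj]
    exact hr (some ⟨j, hj⟩)
  have h1 : algebraMap R (Localization.Away g) (π ^ L * (g ^ M * a ^ m +
      ∑ j ∈ Finset.range m, r' j * π ^ (k * (m - j)) * a ^ j)) =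
      algebraMap R _ (π ^ N * r none) := by
    have hn : algebraMap R (Localization.Away g) (r none) = algebraMap R _ (g ^ M) * s := hr none
    rw [map_mul _ (π ^ N), hn, map_pow, mul_left_comm, ← h]
    simp only [map_mul, map_add, map_sum, map_pow, mul_add, Finset.mul_sum]
    congr 1
    · ring
    · refine Finset.sum_congr rfl fun j hj ↦ ?_
      rw [hr' j (Finset.mem_range.1 hj), map_pow]
      ring
  obtain ⟨⟨_, M', rfl⟩, hM'⟩ := IsLocalization.exists_of_eq (M := Submonoid.powers g) h1
  refine ⟨M' + M, fun j ↦ g ^ M' * r' j, g ^ M' * r none, ?_⟩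
  calc _ = g ^ M' * (π ^ L * (g ^ M * a ^ m +
      ∑ j ∈ Finset.range m, r' j * π ^ (k * (m - j)) * a ^ j)) := by
        simp only [mul_add, Finset.mul_sum, pow_add]
        congr 1
        · ring
        · exact Finset.sum_congr rfl fun j _ ↦ by ring
    _ = g ^ M' * (π ^ N * r none) := hM'
    _ = _ := by ring

theorem smul_pow_add_sum_eq_algebraMap_of_cleared {R : Type*} [CommRing R] {π u a t : R}
    {k m L : ℕ} {r : ℕ → R} {x : Localization.Away π}
    (ha : x * algebraMap R _ π ^ k = algebraMap R _ a)
    (h : π ^ L * (u * a ^ m + ∑ j ∈ Finset.range m, r j * π ^ (k * (m - j)) * a ^ j) =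
      π ^ (L + k * m) * t) :
    u • x ^ m + ∑ j ∈ Finset.range m, r j • x ^ j = algebraMap R _ t := by
  have hu : IsUnit (algebraMap R (Localization.Away π) π ^ (L + k * m)) :=
    (IsLocalization.Away.algebraMap_isUnit π).pow _
  apply hu.mul_left_cancel
  rw [← map_pow, ← map_mul, ← h]
  simp only [map_add, map_sum, map_mul, map_pow, ← ha, Algebra.smul_def, pow_add, mul_assoc]
  congr 1
  rw [mul_add, Finset.mul_sum]
  congr 1
  · rw [mul_pow, ← pow_mul]
    ring
  · refine Finset.sum_congr rfl fun j hj ↦ ?_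
    have hj' : k * m = k * (m - j) + k * j := by
      rw [← mul_add, Nat.sub_add_cancel (Finset.mem_range.1 hj).le]
    rw [hj', mul_pow, ← pow_mul, pow_add]
    ring

theorem Ideal.eq_top_of_sup_span_singleton_eq_top {R : Type*} [CommRing R] {I : Ideal R} (π : R)
    [IsAdicComplete (Ideal.span {π}) R] (h : I ⊔ Ideal.span {π} = ⊤) : I = ⊤ := by
  obtain ⟨y, hy, z, hz, hyz⟩ := Submodule.mem_sup.1 ((Ideal.eq_top_iff_one _).1 h)
  refine I.eq_top_of_isUnit_mem hy (Ideal.isUnit_of_sub_one_mem_jacobson_bot y ?_)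
  rw [← hyz, sub_add_cancel_left]
  exact neg_mem (IsAdicComplete.le_jacobson_bot _ hz)

/-- Let `R` be `π`-adically complete and `π`-torsion-free, and let
`f 1, …, f n ∈ R` generate the unit ideal together with `π`.  If `x ∈ R[1/π]` is such
that for every `i` its image in `R⟨1/f i⟩[1/π]` is integral over `R⟨1/f i⟩`, then `x` is
integral over `R`. -/
theorem stmt14 {R : Type*} [CommRing R] (π : R) (hπ : π ∈ nonZeroDivisors R)
    [IsAdicComplete (Ideal.span {π}) R]
    (n : ℕ) (f : Fin n → R)
    (hf : Ideal.span (Set.range f) ⊔ Ideal.span {π} = ⊤)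
    (x : Localization.Away π)
    (hx : ∀ i : Fin n,
      IsIntegral (piComplAway R π (f i))
        (Localization.awayMap
          ((algebraMap (Localization.Away (f i)) (piComplAway R π (f i))).comp
            (algebraMap R (Localization.Away (f i)))) π x)) :
    IsIntegral R x := by
  obtain ⟨k, a, ha⟩ := IsLocalization.Away.surj π x
  have hloc (i : Fin n) : ∃ m M : ℕ, ∀ d, m < d →
      f i ^ M • x ^ d ∈ (Polynomial.degreeLT R d).map (Polynomial.aeval x).toLinearMap := by
    obtain ⟨m, L, c, hm, hc⟩ := exists_cleared_equation_of_isIntegral_awayMap _ ha (hx i)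
    obtain ⟨c', s, hs⟩ := exists_equation_modulo_pow_of_adicCompletion hc (L + k * m)
    obtain ⟨M, r, t, ht⟩ := exists_pow_mul_equation_of_localizationAway hs
    exact ⟨m, M, fun d hd ↦
      smul_pow_mem_map_degreeLT (smul_pow_add_sum_eq_algebraMap_of_cleared ha ht) hm hd⟩
  choose m M hM using hloc
  apply isIntegral_of_pow_mem_map_degreeLT (d := Finset.univ.sup m + 1)
  refine Submodule.mem_of_span_eq_top_of_smul_pow_mem _ (Set.range f)
    (Ideal.eq_top_of_sup_span_singleton_eq_top π hf) _ ?_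
  rintro ⟨_, i, rfl⟩
  exact ⟨M i, hM i _ (Nat.lt_succ_of_le (Finset.le_sup (Finset.mem_univ i)))⟩
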